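/- Let U ⊆ ℝ² be open, let k₁, k₂, ψ, u : U → ℝ be smooth functions satisfying (k₁)ₓ_y = ψk₁, (k₂)ₓ_y = ψk₂, uₓ = −2(ψ_y + ‖k‖ₓ), u_y = 2(ψₓ + ‖k‖_y), where ‖k‖ = k₁² − k₂², and for λ ∈ ℝ let α_λ denote the 𝔬(4,2)-valued 1-form built from the data (k₁, k₂, ψ, u + λ) by the isothermic frame construction (components α⁰₀ = 0, α¹₀ = dx, α²₀ = dy, α³₀ = α⁴₀ = 0, α²₁ = 0, α³₁ = k₁dx, α³₂ = −k₁dy, α⁴₁ = k₂dx, α⁴₂ = −k₂dy, α⁴₃ = 0, α⁰₁ = ½(u+λ−‖k‖)dx + ψdy, α⁰₂ = ψdx − ½(u+λ+‖k‖)dy, α⁰₃ = (k₁)ₓdx − (k₁)_ydy, α⁰₄ = −(k₂)ₓdx + (k₂)_ydy, remaining entries determined by membership in 𝔬(4,2)). Then: (a) for every λ ∈ ℝ, α_λ satisfies dα_λ + α_λ∧α_λ = 0; (b) α_λ coincides with α₀ in all entries except the components α⁰₁, α⁰₂ (and the dependent entries α¹₅, α²₅); in particular the components α⁰₀, α¹₀,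 α²₀, α²₁, α³₁, α³₂, α⁴₁, α⁴₂ of α_λ and α₀ agree, which are exactly the second order deformation conditions for the corresponding frames. (Hence the T-transform f_λ of an isothermic surface f is a second order conformal deformation of f.) -/

import Mathlib

open Matrix

noncomputable section

attribute [local instance] Matrix.normedAddCommGroup Matrix.normedSpace

abbrev Mat6 := Matrix (Fin 6) (Fin 6) ℝ

/-- Partial derivative in the `x`-direction. -/
def pdx (f : ℝ × ℝ → ℝ) (p : ℝ × ℝ) : ℝ := fderiv ℝ f p (1, 0)

/-- Partial derivative in the `y`-direction. -/
def pdy (f : ℝ × ℝ → ℝ) (p : ℝ × ℝ) : ℝ := fderiv ℝ f p (0, 1)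

/-- The `dx`-coefficient `P` of the isothermic frame form `α = P dx + Q dy` built from
the data `(k₁, k₂, ψ, u)`; entries not prescribed in the statement are determined by
membership in `𝔬(4,2)`. -/
def isoP (k₁ k₂ ψ u : ℝ × ℝ → ℝ) (p : ℝ × ℝ) : Mat6 :=
  !![0, (1/2) * (u p - (k₁ p ^ 2 - k₂ p ^ 2)), ψ p, pdx k₁ p, -(pdx k₂ p), 0;
     1, 0, 0, -(k₁ p), k₂ p, (1/2) * (u p - (k₁ p ^ 2 - k₂ p ^ 2));
     0, 0, 0, 0, 0, ψ p;
     0, k₁ p, 0, 0, 0, pdx k₁ p;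
     0, k₂ p, 0, 0, 0, pdx k₂ p;
     0, 1, 0, 0, 0, 0]

/-- The `dy`-coefficient `Q` of the isothermic frame form `α = P dx + Q dy`. -/
def isoQ (k₁ k₂ ψ u : ℝ × ℝ → ℝ) (p : ℝ × ℝ) : Mat6 :=
  !![0, ψ p, -(1/2) * (u p + (k₁ p ^ 2 - k₂ p ^ 2)), -(pdy k₁ p), pdy k₂ p, 0;
     0, 0, 0, 0, 0, ψ p;
     1, 0, 0, k₁ p, -(k₂ p), -(1/2) * (u p + (k₁ p ^ 2 - k₂ p ^ 2));
     0, 0, -(k₁ p), 0, 0, -(pdy k₁ p);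
     0, 0, -(k₂ p), 0, 0, -(pdy k₂ p);
     0, 0, 1, 0, 0, 0]

/-- Entrywise evaluation of the derivative of a matrix-valued function. -/
theorem fderiv_matrix_apply {M : ℝ × ℝ → Mat6} {p : ℝ × ℝ}
    (h : ∀ i j, DifferentiableAt ℝ (fun q => M q i j) p) (v : ℝ × ℝ) (i j : Fin 6) :
    fderiv ℝ M p v i j = fderiv ℝ (fun q => M q i j) p v := by
  have key (N : ℝ × ℝ → Fin 6 → Fin 6 → ℝ)
      (hN : ∀ i j, DifferentiableAt ℝ (fun q => N q i j) p) :
      fderiv ℝ N p v i j = fderiv ℝ (fun q => N q i j) p v := by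
    have hd : HasFDerivAt N (ContinuousLinearMap.pi fun i => ContinuousLinearMap.pi fun j =>
        fderiv ℝ (fun q => N q i j) p) p :=
      hasFDerivAt_pi.2 fun i => hasFDerivAt_pi.2 fun j => (hN i j).hasFDerivAt
    rw [hd.fderiv]
    rfl
  exact key M h

theorem differentiableAt_fderiv_apply {f : ℝ × ℝ → ℝ} {p : ℝ × ℝ} (hf : ContDiffAt ℝ 2 f p)
    (v : ℝ × ℝ) : DifferentiableAt ℝ (fun q => fderiv ℝ f q v) p :=
  ((hf.fderiv_right (m := 1) (by norm_num)).differentiableAt (by norm_num)).clm_apply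
    (differentiableAt_const v)

theorem pdx_pdy_comm {f : ℝ × ℝ → ℝ} {p : ℝ × ℝ} (hf : ContDiffAt ℝ 2 f p) :
    pdx (pdy f) p = pdy (pdx f) p := by
  have hd : DifferentiableAt ℝ (fderiv ℝ f) p :=
    (hf.fderiv_right (m := 1) (by norm_num)).differentiableAt (by norm_num)
  have key (v w : ℝ × ℝ) :
      fderiv ℝ (fun q => fderiv ℝ f q v) p w = fderiv ℝ (fderiv ℝ f) p w v := by
    rw [fderiv_clm_apply hd (differentiableAt_const v)]
    simp
  have hs : IsSymmSndFDerivAt ℝ f p := hf.isSymmSndFDerivAt (by simp)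
  exact (key (0, 1) (1, 0)).trans ((hs.eq (1, 0) (0, 1)).trans (key (1, 0) (0, 1)).symm)

theorem fderiv_sq_sub_sq {f g : ℝ × ℝ → ℝ} {p : ℝ × ℝ} (hf : DifferentiableAt ℝ f p)
    (hg : DifferentiableAt ℝ g p) (v : ℝ × ℝ) :
    fderiv ℝ (fun q => f q ^ 2 - g q ^ 2) p v =
      2 * f p * fderiv ℝ f p v - 2 * g p * fderiv ℝ g p v := by
  rw [fderiv_fun_sub (hf.fun_pow 2) (hg.fun_pow 2), fderiv_fun_pow 2 hf, fderiv_fun_pow 2 hg]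
  simp

section FrameForm

variable {k₁ k₂ ψ u : ℝ × ℝ → ℝ} {p : ℝ × ℝ}

theorem fderiv_isoP_apply (hk₁ : ContDiffAt ℝ 2 k₁ p) (hk₂ : ContDiffAt ℝ 2 k₂ p)
    (hψ : DifferentiableAt ℝ ψ p) (hu : DifferentiableAt ℝ u p) (v : ℝ × ℝ) :
    fderiv ℝ (isoP k₁ k₂ ψ u) p v =
      !![0, (1/2) * (fderiv ℝ u p v - fderiv ℝ (fun q => k₁ q ^ 2 - k₂ q ^ 2) p v),
          fderiv ℝ ψ p v, fderiv ℝ (pdx k₁) p v, -(fderiv ℝ (pdx k₂) p v), 0;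
         0, 0, 0, -(fderiv ℝ k₁ p v), fderiv ℝ k₂ p v,
          (1/2) * (fderiv ℝ u p v - fderiv ℝ (fun q => k₁ q ^ 2 - k₂ q ^ 2) p v);
         0, 0, 0, 0, 0, fderiv ℝ ψ p v;
         0, fderiv ℝ k₁ p v, 0, 0, 0, fderiv ℝ (pdx k₁) p v;
         0, fderiv ℝ k₂ p v, 0, 0, 0, fderiv ℝ (pdx k₂) p v;
         0, 0, 0, 0, 0, 0] := by
  have d₁ : DifferentiableAt ℝ k₁ p := hk₁.differentiableAt (by norm_num)
  have d₂ : DifferentiableAt ℝ k₂ p := hk₂.differentiableAt (by norm_num)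
  have e₁ : DifferentiableAt ℝ (pdx k₁) p := differentiableAt_fderiv_apply hk₁ _
  have e₂ : DifferentiableAt ℝ (pdx k₂) p := differentiableAt_fderiv_apply hk₂ _
  have hn : DifferentiableAt ℝ (fun q => k₁ q ^ 2 - k₂ q ^ 2) p := (d₁.pow 2).sub (d₂.pow 2)
  have hm : fderiv ℝ (fun q => (1/2) * (u q - (k₁ q ^ 2 - k₂ q ^ 2))) p v =
      (1/2) * (fderiv ℝ u p v - fderiv ℝ (fun q => k₁ q ^ 2 - k₂ q ^ 2) p v) := by
    rw [fderiv_const_mul (hu.fun_sub hn), fderiv_fun_sub hu hn]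
    simp
  ext i j
  rw [fderiv_matrix_apply]
  · fin_cases i <;> fin_cases j <;>
      first
      | exact hm
      | simp [isoP]
  · intro i j
    fin_cases i <;> fin_cases j <;> simp [isoP] <;> fun_prop

theorem fderiv_isoQ_apply (hk₁ : ContDiffAt ℝ 2 k₁ p) (hk₂ : ContDiffAt ℝ 2 k₂ p)
    (hψ : DifferentiableAt ℝ ψ p) (hu : DifferentiableAt ℝ u p) (v : ℝ × ℝ) :
    fderiv ℝ (isoQ k₁ k₂ ψ u) p v =
      !![0, fderiv ℝ ψ p v,
          -(1/2) * (fderiv ℝ u p v + fderiv ℝ (fun q => k₁ q ^ 2 - k₂ q ^ 2) p v),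
          -(fderiv ℝ (pdy k₁) p v), fderiv ℝ (pdy k₂) p v, 0;
         0, 0, 0, 0, 0, fderiv ℝ ψ p v;
         0, 0, 0, fderiv ℝ k₁ p v, -(fderiv ℝ k₂ p v),
          -(1/2) * (fderiv ℝ u p v + fderiv ℝ (fun q => k₁ q ^ 2 - k₂ q ^ 2) p v);
         0, 0, -(fderiv ℝ k₁ p v), 0, 0, -(fderiv ℝ (pdy k₁) p v);
         0, 0, -(fderiv ℝ k₂ p v), 0, 0, -(fderiv ℝ (pdy k₂) p v);
         0, 0, 0, 0, 0, 0] := by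
  have d₁ : DifferentiableAt ℝ k₁ p := hk₁.differentiableAt (by norm_num)
  have d₂ : DifferentiableAt ℝ k₂ p := hk₂.differentiableAt (by norm_num)
  have e₁ : DifferentiableAt ℝ (pdy k₁) p := differentiableAt_fderiv_apply hk₁ _
  have e₂ : DifferentiableAt ℝ (pdy k₂) p := differentiableAt_fderiv_apply hk₂ _
  have hn : DifferentiableAt ℝ (fun q => k₁ q ^ 2 - k₂ q ^ 2) p := (d₁.pow 2).sub (d₂.pow 2)
  have hm : fderiv ℝ (fun q => -(1/2) * (u q + (k₁ q ^ 2 - k₂ q ^ 2))) p v =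
      -(1/2) * (fderiv ℝ u p v + fderiv ℝ (fun q => k₁ q ^ 2 - k₂ q ^ 2) p v) := by
    rw [fderiv_const_mul (hu.fun_add hn), fderiv_fun_add hu hn]
    simp
    ring
  ext i j
  rw [fderiv_matrix_apply]
  · fin_cases i <;> fin_cases j <;>
      first
      | exact hm
      | simp [isoQ]
  · intro i j
    fin_cases i <;> fin_cases j <;> simp [isoQ] <;> fun_prop

set_option maxHeartbeats 2000000 in
/-- The Maurer–Cartan equation of the isothermic frame form at a point where the structure
system holds. -/
theorem iso_maurer_cartan (hk₁ : ContDiffAt ℝ 2 k₁ p) (hk₂ : ContDiffAt ℝ 2 k₂ p)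
    (hψ : DifferentiableAt ℝ ψ p) (hu : DifferentiableAt ℝ u p)
    (h₁ : pdy (pdx k₁) p = ψ p * k₁ p) (h₂ : pdy (pdx k₂) p = ψ p * k₂ p)
    (hux : pdx u p = -2 * (pdy ψ p + pdx (fun q => k₁ q ^ 2 - k₂ q ^ 2) p))
    (huy : pdy u p = 2 * (pdx ψ p + pdy (fun q => k₁ q ^ 2 - k₂ q ^ 2) p)) :
    fderiv ℝ (isoQ k₁ k₂ ψ u) p (1, 0) - fderiv ℝ (isoP k₁ k₂ ψ u) p (0, 1) +
      (isoP k₁ k₂ ψ u p * isoQ k₁ k₂ ψ u p - isoQ k₁ k₂ ψ u p * isoP k₁ k₂ ψ u p) = 0 := by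
  have d₁ : DifferentiableAt ℝ k₁ p := hk₁.differentiableAt (by norm_num)
  have d₂ : DifferentiableAt ℝ k₂ p := hk₂.differentiableAt (by norm_num)
  have h₁' := (pdx_pdy_comm hk₁).trans h₁
  have h₂' := (pdx_pdy_comm hk₂).trans h₂
  have hnx : pdx (fun q => k₁ q ^ 2 - k₂ q ^ 2) p = 2 * k₁ p * pdx k₁ p - 2 * k₂ p * pdx k₂ p :=
    fderiv_sq_sub_sq d₁ d₂ _
  have hny : pdy (fun q => k₁ q ^ 2 - k₂ q ^ 2) p = 2 * k₁ p * pdy k₁ p - 2 * k₂ p * pdy k₂ p :=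
    fderiv_sq_sub_sq d₁ d₂ _
  have hx (f : ℝ × ℝ → ℝ) : fderiv ℝ f p (1, 0) = pdx f p := rfl
  have hy (f : ℝ × ℝ → ℝ) : fderiv ℝ f p (0, 1) = pdy f p := rfl
  rw [fderiv_isoP_apply hk₁ hk₂ hψ hu, fderiv_isoQ_apply hk₁ hk₂ hψ hu]
  simp only [hx, hy, h₁, h₂, h₁', h₂', hux, huy, hnx, hny]
  ext i j
  fin_cases i <;> fin_cases j <;>
    simp [isoP, isoQ] <;> ring

end FrameForm

/-- if `(k₁, k₂, ψ, u)` satisfies the isothermic structure system, then for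
each `λ ∈ ℝ` the frame form `α_λ` built from `(k₁, k₂, ψ, u + λ)` satisfies the
Maurer–Cartan equation on `U`, and `α_λ` agrees with `α₀` in all entries except
`α⁰₁, α⁰₂` (and the dependent entries `α¹₅, α²₅`); in particular the components
`α⁰₀, α¹₀, α²₀, α²₁, α³₁, α³₂, α⁴₁, α⁴₂` of `α_λ` and `α₀` agree, which are exactly
the second order deformation conditions.  (Hence the T-transform `f_λ` of an
isothermic surface `f` is a second order conformal deformation of `f`.) -/
theorem t_transform_is_second_order_deformation
    (U : Set (ℝ × ℝ)) (hU : IsOpen U) (k₁ k₂ ψ u : ℝ × ℝ → ℝ)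
    (hk₁ : ContDiffOn ℝ (⊤ : ℕ∞) k₁ U) (hk₂ : ContDiffOn ℝ (⊤ : ℕ∞) k₂ U)
    (hψ : ContDiffOn ℝ (⊤ : ℕ∞) ψ U) (hu : ContDiffOn ℝ (⊤ : ℕ∞) u U)
    (hstruct : ∀ p ∈ U,
      pdy (pdx k₁) p = ψ p * k₁ p ∧
      pdy (pdx k₂) p = ψ p * k₂ p ∧
      pdx u p = -2 * (pdy ψ p + pdx (fun q => k₁ q ^ 2 - k₂ q ^ 2) p) ∧
      pdy u p = 2 * (pdx ψ p + pdy (fun q => k₁ q ^ 2 - k₂ q ^ 2) p)) :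
    -- (a) Maurer–Cartan equation for every λ
    (∀ l : ℝ, ∀ p ∈ U,
      fderiv ℝ (isoQ k₁ k₂ ψ (fun q => u q + l)) p (1, 0) -
        fderiv ℝ (isoP k₁ k₂ ψ (fun q => u q + l)) p (0, 1) +
        (isoP k₁ k₂ ψ (fun q => u q + l) p * isoQ k₁ k₂ ψ (fun q => u q + l) p -
          isoQ k₁ k₂ ψ (fun q => u q + l) p * isoP k₁ k₂ ψ (fun q => u q + l) p) = 0)
    ∧
    -- (b) α_λ = α₀ in all entries except α⁰₁, α⁰₂, α¹₅, α²₅ ...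
    (∀ l : ℝ, ∀ p : ℝ × ℝ, ∀ i j : Fin 6,
      (i, j) ≠ ((0 : Fin 6), (1 : Fin 6)) → (i, j) ≠ ((0 : Fin 6), (2 : Fin 6)) →
      (i, j) ≠ ((1 : Fin 6), (5 : Fin 6)) → (i, j) ≠ ((2 : Fin 6), (5 : Fin 6)) →
        isoP k₁ k₂ ψ (fun q => u q + l) p i j = isoP k₁ k₂ ψ u p i j ∧
        isoQ k₁ k₂ ψ (fun q => u q + l) p i j = isoQ k₁ k₂ ψ u p i j)
    ∧
    -- ... in particular the second order deformation components agree
    (∀ l : ℝ, ∀ p : ℝ × ℝ,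
      ∀ ij ∈ ([(0,0), (1,0), (2,0), (2,1), (3,1), (3,2), (4,1), (4,2)] :
          List (Fin 6 × Fin 6)),
        isoP k₁ k₂ ψ (fun q => u q + l) p ij.1 ij.2 = isoP k₁ k₂ ψ u p ij.1 ij.2 ∧
        isoQ k₁ k₂ ψ (fun q => u q + l) p ij.1 ij.2 = isoQ k₁ k₂ ψ u p ij.1 ij.2) := by
  have at_p {f : ℝ × ℝ → ℝ} (hf : ContDiffOn ℝ (⊤ : ℕ∞) f U) {p : ℝ × ℝ} (hp : p ∈ U) :
      ContDiffAt ℝ 2 f p :=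
    (hf.contDiffAt (hU.mem_nhds hp)).of_le (WithTop.coe_le_coe.2 le_top)
  refine ⟨fun l p hp => ?_, fun l p i j h₀₁ h₀₂ h₁₅ h₂₅ => ?_, fun l p ij hij => ?_⟩
  · obtain ⟨h₁, h₂, hux, huy⟩ := hstruct p hp
    have du : DifferentiableAt ℝ u p := (at_p hu hp).differentiableAt (by norm_num)
    have hd (v : ℝ × ℝ) : fderiv ℝ (fun q => u q + l) p v = fderiv ℝ u p v := by
      rw [fderiv_add_const]
    exact iso_maurer_cartan (at_p hk₁ hp) (at_p hk₂ hp)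
      ((at_p hψ hp).differentiableAt (by norm_num)) (du.add_const l) h₁ h₂
      ((hd _).trans hux) ((hd _).trans huy)
  · fin_cases i <;> fin_cases j <;> simp [isoP, isoQ] at h₀₁ h₀₂ h₁₅ h₂₅ ⊢
  · fin_cases hij <;> simp [isoP, isoQ]
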